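/- Equip Baire space ℕ → ℕ with the metric d(x,y) = (1/2)^n where n is the least index with x n ≠ y n (and d(x,y) = 0 if x = y). Let f : (ℕ → ℕ) → ℝ be lower semicontinuous with range bounded below, and let ε > 0. Then there exists x* : ℕ → ℕ such that for every y ≠ x*, f x* < f y + ε · d(x*, y). -/

import Mathlib

open Classical

/-- The standard metric on Baire space: `d(x,y) = (1/2)^n` where `n` is the
least index with `x n ≠ y n`, and `d(x,y) = 0` if `x = y`. -/
noncomputable def baireDist (x y : ℕ → ℕ) : ℝ :=
  if h : x = y then 0 else (1/2 : ℝ) ^ Nat.find (Function.ne_iff.mp h)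

/-- **Ekeland's variational principle**: a lower semicontinuous function bounded below on a nonempty
complete metric space has a point that is a strict minimiser up to a perturbation `ε * dist`. -/
theorem LowerSemicontinuous.exists_lt_add_mul_dist {X : Type*} [MetricSpace X] [CompleteSpace X]
    [Nonempty X] {f : X → ℝ} (hf : LowerSemicontinuous f) (hbd : BddBelow (Set.range f))
    {ε : ℝ} (hε : 0 < ε) : ∃ x, ∀ y, y ≠ x → f x < f y + ε * dist x y := by
  let S : X → Set X := fun x => {y | f y + ε * dist x y ≤ f x}
  have self_mem (x : X) : x ∈ S x := by simp [S]
  have S_trans {x y z : X} (hy : y ∈ S x) (hz : z ∈ S y) : z ∈ S x := by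
    simp only [S, Set.mem_ofPred_eq] at *
    have := mul_le_mul_of_nonneg_left (dist_triangle x y z) hε.le
    linarith
  have S_closed (x : X) : IsClosed (S x) := by
    have h : LowerSemicontinuous fun y => f y + ε * dist x y :=
      hf.add (Continuous.lowerSemicontinuous (by fun_prop))
    exact h.isClosed_preimage (f x)
  have near_min (x : X) (n : ℕ) : ∃ z ∈ S x, ∀ y ∈ S x, f z ≤ f y + (1 / 2 : ℝ) ^ n := by
    have hb : BddBelow (f '' S x) := hbd.mono (Set.image_subset_range _ _)
    obtain ⟨_, ⟨z, hz, rfl⟩, hlt⟩ := Real.lt_sInf_add_pos (s := f '' S x)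
      ⟨_, x, self_mem x, rfl⟩ (show (0 : ℝ) < (1 / 2) ^ n by positivity)
    refine ⟨z, hz, fun y hy => ?_⟩
    linarith [csInf_le hb ⟨y, hy, rfl⟩]
  choose g g_mem g_le using near_min
  let u : ℕ → X := fun n => Nat.rec (Classical.arbitrary X) (fun n x => g x n) n
  have u_mem {n m : ℕ} (h : n ≤ m) : u m ∈ S (u n) := by
    induction m, h using Nat.le_induction with
    | base => exact self_mem _
    | succ m _ ih => exact S_trans ih (g_mem _ _)
  have dist_le {n : ℕ} {y : X} (hy : y ∈ S (u (n + 1))) :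
      dist (u (n + 1)) y ≤ 1 / ε * (1 / 2 : ℝ) ^ n := by
    have hle : f (u (n + 1)) ≤ f y + (1 / 2 : ℝ) ^ n :=
      g_le _ _ _ (S_trans (u_mem n.le_succ) hy)
    have hy' : f y + ε * dist (u (n + 1)) y ≤ f (u (n + 1)) := hy
    rw [one_div_mul_eq_div, le_div_iff₀' hε]
    linarith
  obtain ⟨x, hx⟩ := cauchySeq_tendsto_of_complete
    (cauchySeq_of_le_geometric (f := fun n => u (n + 1)) (1 / 2) (1 / ε) (by norm_num)
      fun n => dist_le (u_mem (n + 1).le_succ))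
  have x_mem (n : ℕ) : x ∈ S (u n) :=
    (S_closed _).mem_of_tendsto hx <| Filter.eventually_atTop.2
      ⟨n, fun m hm => u_mem (hm.trans m.le_succ)⟩
  refine ⟨x, fun y hne => lt_of_not_ge fun hy => hne ?_⟩
  refine tendsto_nhds_unique (tendsto_iff_dist_tendsto_zero.2 ?_) hx
  refine squeeze_zero (fun _ => dist_nonneg) (fun n => dist_le (S_trans (x_mem (n + 1)) hy)) ?_
  simpa using (tendsto_pow_atTop_nhds_zero_of_lt_one (r := (1 / 2 : ℝ)) (by norm_num)
    (by norm_num)).const_mul (1 / ε)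

theorem baireDist_eq_piNat_dist (x y : ℕ → ℕ) :
    baireDist x y = (PiNat.dist : Dist (ℕ → ℕ)).dist x y := by
  by_cases h : x = y
  · subst h
    simp [baireDist, PiNat.dist_self]
  · rw [PiNat.dist_eq_of_ne h, baireDist, dif_neg h, PiNat.firstDiff_def, dif_pos h]
    congr!

/-- Ekeland's variational principle for total (lower semicontinuous) potentials
on `ℕ^ℕ` that are bounded below. -/
theorem ekeland_baire_lsc (f : (ℕ → ℕ) → ℝ) (hf : LowerSemicontinuous f)
    (hbd : BddBelow (Set.range f)) (ε : ℝ) (hε : 0 < ε) :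
    ∃ x : ℕ → ℕ, ∀ y : ℕ → ℕ, y ≠ x → f x < f y + ε * baireDist x y := by
  let _ : MetricSpace (ℕ → ℕ) := PiNat.metricSpaceNatNat
  obtain ⟨x, hx⟩ := hf.exists_lt_add_mul_dist hbd hε
  refine ⟨x, fun y hy => ?_⟩
  rw [baireDist_eq_piNat_dist]
  exact hx y hy
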